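/- Let K'_p be the subgroup of K̃ of elements all of whose entries reduce modulo m_L into the prime field 𝔽_p, and let I'_p ≤ K'_p consist of those elements whose reduction in addition has zero entries at positions (1,2), (3,1), (3,2), (4,1), (4,2), (4,3). Let s₁ be the matrix with rows (0,1,0,0), (1,0,0,0), (0,0,0,1), (0,0,1,0). Then: (a) the sets P·K'_p and P·Θ·K'_p are disjoint; (b) for every l ∈ ℤ and every integer m > 0, the element Θ·h(l,m)·t_i lies in P·I'_p for i ∈ {3, 5}, lies in P·s₁·I'_p for i ∈ {4, 6}, and lies in neither P·I'_p nor P·s₁·I'_p for i ∈ {1, 2, 7, 8}; (c) for m = 0 and every l ∈ ℤ, the element Θ·h(l,0)·t_i lies in P·Θ·K'_p, and hence in neither P·I'_p nor P·s₁·I'_p, for all i ∈ {1, 2, 5, 7}. -/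

import Mathlib

open Matrix

noncomputable section

variable (p : ℕ) [Fact p.Prime]

/-- The 4×4 symplectic similitude matrix `J`. -/
def Jmat : Matrix (Fin 4) (Fin 4) ℚ_[p] :=
  !![0,0,1,0; 0,0,0,1; -1,0,0,0; 0,-1,0,0]

/-- `GSp₄(ℚ_p)`. -/
def GSp4 : Set (Matrix (Fin 4) (Fin 4) ℚ_[p]) :=
  {g | IsUnit g.det ∧ ∃ μ : ℚ_[p]ˣ, gᵀ * Jmat p * g = (μ : ℚ_[p]) • Jmat p}

/-- `K_p = GSp₄(ℤ_p)`, viewed inside `GSp₄(ℚ_p)`. -/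
def Kp : Set (Matrix (Fin 4) (Fin 4) ℚ_[p]) :=
  {g | g ∈ GSp4 p ∧ (∀ i j, ‖g i j‖ ≤ 1) ∧ ‖g.det‖ = 1}

/-- The Iwahori subgroup `I_p`: elements of `K_p` whose reduction mod `p` has zero
entries at positions (1,2), (3,1), (3,2), (4,1), (4,2), (4,3) (0-indexed below). -/
def Ip : Set (Matrix (Fin 4) (Fin 4) ℚ_[p]) :=
  {g | g ∈ Kp p ∧ ‖g 0 1‖ < 1 ∧ ‖g 2 0‖ < 1 ∧ ‖g 2 1‖ < 1 ∧
      ‖g 3 0‖ < 1 ∧ ‖g 3 1‖ < 1 ∧ ‖g 3 2‖ < 1}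

/-- The matrix `U_x` for `x = (n,q,r)`. -/
def Umat (n q r : ℚ_[p]) : Matrix (Fin 4) (Fin 4) ℚ_[p] :=
  !![1,0,n,q; 0,1,q,r; 0,0,1,0; 0,0,0,1]

/-- The matrix `Z_y` for `y ∈ ℤ_p`. -/
def Zmat (y : ℚ_[p]) : Matrix (Fin 4) (Fin 4) ℚ_[p] :=
  !![1,y,0,0; 0,1,0,0; 0,0,1,0; 0,0,-y,1]

/-- The matrix `Z_∞`. -/
def Zinf : Matrix (Fin 4) (Fin 4) ℚ_[p] :=
  !![0,1,0,0; 1,0,0,0; 0,0,0,1; 0,0,1,0]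

/-- `t₁ = B_{(1,0,0)}^0`. -/
def t1 : Matrix (Fin 4) (Fin 4) ℚ_[p] := Jmat p * Umat p 1 0 0 * Jmat p * Zmat p 0
/-- `t₂ = B_{(1,0,0)}^∞`. -/
def t2 : Matrix (Fin 4) (Fin 4) ℚ_[p] := Jmat p * Umat p 1 0 0 * Jmat p * Zinf p
/-- `t₃ = B_{(0,0,1)}^0`. -/
def t3 : Matrix (Fin 4) (Fin 4) ℚ_[p] := Jmat p * Umat p 0 0 1 * Jmat p * Zmat p 0
/-- `t₄ = B_{(0,0,1)}^∞`. -/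
def t4 : Matrix (Fin 4) (Fin 4) ℚ_[p] := Jmat p * Umat p 0 0 1 * Jmat p * Zinf p
/-- `t₅ = B_{(0,0,0)}^0`. -/
def t5 : Matrix (Fin 4) (Fin 4) ℚ_[p] := Jmat p * Umat p 0 0 0 * Jmat p * Zmat p 0
/-- `t₆ = B_{(0,0,0)}^∞`. -/
def t6 : Matrix (Fin 4) (Fin 4) ℚ_[p] := Jmat p * Umat p 0 0 0 * Jmat p * Zinf p
/-- `t₇ = A_{(0,0,0)}^0`. -/
def t7 : Matrix (Fin 4) (Fin 4) ℚ_[p] := Umat p 0 0 0 * Jmat p * Zmat p 0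
/-- `t₈ = A_{(0,0,0)}^∞`. -/
def t8 : Matrix (Fin 4) (Fin 4) ℚ_[p] := Umat p 0 0 0 * Jmat p * Zinf p

/-- `T_m`: `{t₁,…,t₈}` if `m > 0`, and `{t₁, t₂, t₅, t₇}` if `m = 0`. -/
def TsetM (m : ℕ) : Set (Matrix (Fin 4) (Fin 4) ℚ_[p]) :=
  if m = 0 then {t1 p, t2 p, t5 p, t7 p}
  else {t1 p, t2 p, t3 p, t4 p, t5 p, t6 p, t7 p, t8 p}

/-- `h(l,m) = diag(p^{2m+l}, p^{m+l}, 1, p^m)`. -/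
def hmat (l : ℤ) (m : ℕ) : Matrix (Fin 4) (Fin 4) ℚ_[p] :=
  diagonal ![(p : ℚ_[p]) ^ (2 * (m : ℤ) + l), (p : ℚ_[p]) ^ ((m : ℤ) + l), 1, (p : ℚ_[p]) ^ (m : ℤ)]

variable (L : Type) [NormedField L] [Algebra ℚ_[p] L]

/-- The 4×4 matrix `J` over `L`. -/
def JmatL : Matrix (Fin 4) (Fin 4) L :=
  !![0,0,1,0; 0,0,0,1; -1,0,0,0; 0,-1,0,0]

/-- The unitary similitude group `G̃ = GU(2,2;L)` (with conjugation `σ`). -/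
def GU (σ : L ≃+* L) : Set (Matrix (Fin 4) (Fin 4) L) :=
  {g | ∃ μ : ℚ_[p], μ ≠ 0 ∧
    (g.map σ)ᵀ * JmatL L * g = algebraMap ℚ_[p] L μ • JmatL L}

/-- `K̃ = G̃ ∩ GL₄(O_L)`. -/
def Ktilde (σ : L ≃+* L) : Set (Matrix (Fin 4) (Fin 4) L) :=
  {g | g ∈ GU p L σ ∧ (∀ i j, ‖g i j‖ ≤ 1) ∧ ‖g.det‖ = 1}

/-- The parabolic subgroup `P` of `G̃`: vanishing (2,1), (3,1), (4,1) entries. -/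
def Ptilde (σ : L ≃+* L) : Set (Matrix (Fin 4) (Fin 4) L) :=
  {g | g ∈ GU p L σ ∧ g 1 0 = 0 ∧ g 2 0 = 0 ∧ g 3 0 = 0}

/-- The element `Θ`, built from `α = (b + √−d)/(2c)`. -/
def Theta (σ : L ≃+* L) (sqd : L) (b c : ℚ_[p]) : Matrix (Fin 4) (Fin 4) L :=
  !![1,0,0,0;
     (algebraMap ℚ_[p] L b + sqd) / (2 * algebraMap ℚ_[p] L c),1,0,0;
     0,0,1,-σ ((algebraMap ℚ_[p] L b + sqd) / (2 * algebraMap ℚ_[p] L c));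
     0,0,0,1]

/-- Base change of a matrix from `ℚ_p` to `L`. -/
def mapL (g : Matrix (Fin 4) (Fin 4) ℚ_[p]) : Matrix (Fin 4) (Fin 4) L :=
  g.map (algebraMap ℚ_[p] L)

/-- `K'_p`: elements of `K̃` all of whose entries reduce mod `m_L` into the
prime field `𝔽_p` (i.e. each entry is within distance `< 1` of an element of `ℤ_p`). -/
def Kprime (σ : L ≃+* L) : Set (Matrix (Fin 4) (Fin 4) L) :=
  {g | g ∈ Ktilde p L σ ∧
    ∀ i j, ∃ u : ℚ_[p], ‖u‖ ≤ 1 ∧ ‖g i j - algebraMap ℚ_[p] L u‖ < 1}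

/-- `I'_p`: elements of `K'_p` whose reduction has zero entries at positions
(1,2), (3,1), (3,2), (4,1), (4,2), (4,3). -/
def Iprime (σ : L ≃+* L) : Set (Matrix (Fin 4) (Fin 4) L) :=
  {g | g ∈ Kprime p L σ ∧ ‖g 0 1‖ < 1 ∧ ‖g 2 0‖ < 1 ∧ ‖g 2 1‖ < 1 ∧
    ‖g 3 0‖ < 1 ∧ ‖g 3 1‖ < 1 ∧ ‖g 3 2‖ < 1}

/-- The matrix `s₁`. -/
def s1L : Matrix (Fin 4) (Fin 4) L :=
  !![0,1,0,0; 1,0,0,0; 0,0,0,1; 0,0,1,0]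

/-- `P·K'_p`. -/
def PKprime (σ : L ≃+* L) : Set (Matrix (Fin 4) (Fin 4) L) :=
  {x | ∃ q ∈ Ptilde p L σ, ∃ k ∈ Kprime p L σ, x = q * k}

/-- `P·Θ·K'_p`. -/
def PThetaKprime (σ : L ≃+* L) (sqd : L) (b c : ℚ_[p]) :
    Set (Matrix (Fin 4) (Fin 4) L) :=
  {x | ∃ q ∈ Ptilde p L σ, ∃ k ∈ Kprime p L σ, x = q * Theta p L σ sqd b c * k}

/-- `P·I'_p`. -/
def PIprime (σ : L ≃+* L) : Set (Matrix (Fin 4) (Fin 4) L) :=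
  {x | ∃ q ∈ Ptilde p L σ, ∃ k ∈ Iprime p L σ, x = q * k}

/-- `P·s₁·I'_p`. -/
def Ps1Iprime (σ : L ≃+* L) : Set (Matrix (Fin 4) (Fin 4) L) :=
  {x | ∃ q ∈ Ptilde p L σ, ∃ k ∈ Iprime p L σ, x = q * s1L L * k}


section Helpers

variable {p L}

lemma GU_mul {σ : L ≃+* L} {g h : Matrix (Fin 4) (Fin 4) L}
    (hg : g ∈ GU p L σ) (hh : h ∈ GU p L σ) : g * h ∈ GU p L σ := by
  obtain ⟨μ, hμ, hg⟩ := hg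
  obtain ⟨ν, hν, hh⟩ := hh
  refine ⟨μ * ν, mul_ne_zero hμ hν, ?_⟩
  have hmap : (g * h).map σ = g.map σ * h.map σ := Matrix.map_mul
  calc ((g * h).map σ)ᵀ * JmatL L * (g * h)
      = (h.map σ)ᵀ * ((g.map σ)ᵀ * JmatL L * g) * h := by
        rw [hmap, transpose_mul]; simp only [Matrix.mul_assoc]
    _ = algebraMap ℚ_[p] L (μ * ν) • JmatL L := by
        rw [hg, Matrix.mul_smul, Matrix.smul_mul, hh, smul_smul, map_mul]

lemma mapL_mem_GU {σ : L ≃+* L}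
    (hσ : ∀ x : ℚ_[p], σ (algebraMap ℚ_[p] L x) = algebraMap ℚ_[p] L x)
    {g : Matrix (Fin 4) (Fin 4) ℚ_[p]} (hg : g ∈ GSp4 p) : mapL p L g ∈ GU p L σ := by
  obtain ⟨-, μ, hg⟩ := hg
  refine ⟨μ, μ.ne_zero, ?_⟩
  have hfix : (mapL p L g).map σ = mapL p L g := by ext i j; simp [mapL, hσ]
  have hJ : (Jmat p).map (algebraMap ℚ_[p] L) = JmatL L := by
    ext i j; fin_cases i <;> fin_cases j <;> simp [Jmat, JmatL]
  have h := congrArg (fun M => M.map (algebraMap ℚ_[p] L)) hg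
  simp only [Matrix.map_mul, hJ, transpose_map] at h
  rw [hfix, mapL, h, ← hJ]
  ext i j
  simp

/-- Left multiplication by an element of `P` rescales the third row. -/
lemma Ptilde_mul_row {σ : L ≃+* L} {q : Matrix (Fin 4) (Fin 4) L} (hq : q ∈ Ptilde p L σ) :
    ∃ r : L, r ≠ 0 ∧ ∀ (y : Matrix (Fin 4) (Fin 4) L) j, (q * y) 2 j = r * y 2 j := by
  obtain ⟨⟨μ, hμ, hq⟩, h1, h2, h3⟩ := hq
  have hμ' : algebraMap ℚ_[p] L μ ≠ 0 := by simpa using hμ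
  have key : ∀ j, σ (q 0 0) * q 2 j = algebraMap ℚ_[p] L μ * JmatL L 0 j := by
    intro j
    have h := congrFun (congrFun hq 0) j
    fin_cases j <;>
      simpa [Matrix.mul_apply, Fin.sum_univ_four, JmatL, h1, h2, h3] using h
  have k0 := key 0
  have k1 := key 1
  have k2 := key 2
  have k3 := key 3
  simp only [JmatL, of_apply, cons_val', cons_val, mul_zero, mul_one] at k0 k1 k2 k3
  have hne : σ (q 0 0) ≠ 0 := by
    intro h; rw [h, zero_mul] at k2; exact hμ' k2.symm
  have e0 : q 2 0 = 0 := (mul_eq_zero.mp k0).resolve_left hne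
  have e1 : q 2 1 = 0 := (mul_eq_zero.mp k1).resolve_left hne
  have e3 : q 2 3 = 0 := (mul_eq_zero.mp k3).resolve_left hne
  refine ⟨q 2 2, fun h => hμ' (by rw [← k2, h, mul_zero]), fun y j => ?_⟩
  simp [Matrix.mul_apply, Fin.sum_univ_four, e0, e1, e3]

lemma norm_mul_le_one {x y : L} (hx : ‖x‖ ≤ 1) (hy : ‖y‖ ≤ 1) : ‖x * y‖ ≤ 1 := by
  rw [norm_mul]; exact mul_le_one₀ hx (norm_nonneg y) hy

lemma norm_mul_lt_one_of_le_of_lt {x y : L} (hx : ‖x‖ ≤ 1) (hy : ‖y‖ < 1) : ‖x * y‖ < 1 := by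
  rw [norm_mul]; exact (mul_le_of_le_one_left (norm_nonneg y) hx).trans_lt hy

lemma norm_mul_lt_one_of_lt_of_le {x y : L} (hx : ‖x‖ < 1) (hy : ‖y‖ ≤ 1) : ‖x * y‖ < 1 := by
  rw [mul_comm]; exact norm_mul_lt_one_of_le_of_lt hy hx

/-- Laplace expansion of a `4 × 4` determinant along the first two and the last two rows. -/
lemma det_fin_four_laplace {R : Type*} [CommRing R] (g : Matrix (Fin 4) (Fin 4) R) :
    g.det =
      (g 0 0 * g 1 1 - g 0 1 * g 1 0) * (g 2 2 * g 3 3 - g 2 3 * g 3 2)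
      - (g 0 0 * g 1 2 - g 0 2 * g 1 0) * (g 2 1 * g 3 3 - g 2 3 * g 3 1)
      + (g 0 0 * g 1 3 - g 0 3 * g 1 0) * (g 2 1 * g 3 2 - g 2 2 * g 3 1)
      + (g 0 1 * g 1 2 - g 0 2 * g 1 1) * (g 2 0 * g 3 3 - g 2 3 * g 3 0)
      - (g 0 1 * g 1 3 - g 0 3 * g 1 1) * (g 2 0 * g 3 2 - g 2 2 * g 3 0)
      + (g 0 2 * g 1 3 - g 0 3 * g 1 2) * (g 2 0 * g 3 1 - g 2 1 * g 3 0) := by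
  rw [det_succ_row_zero]
  simp [Fin.sum_univ_four, det_fin_three, Fin.succAbove]
  ring

section Ultrametric

variable [IsUltrametricDist L]

lemma norm_sub_le_max (x y : L) : ‖x - y‖ ≤ max ‖x‖ ‖y‖ := by
  simpa [sub_eq_add_neg] using IsUltrametricDist.norm_add_le_max x (-y)

lemma norm_sub_lt_one {x y : L} (hx : ‖x‖ < 1) (hy : ‖y‖ < 1) : ‖x - y‖ < 1 :=
  (norm_sub_le_max x y).trans_lt (max_lt hx hy)

lemma norm_add_lt_one {x y : L} (hx : ‖x‖ < 1) (hy : ‖y‖ < 1) : ‖x + y‖ < 1 :=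
  (IsUltrametricDist.norm_add_le_max x y).trans_lt (max_lt hx hy)

lemma norm_sub_le_one {x y : L} (hx : ‖x‖ ≤ 1) (hy : ‖y‖ ≤ 1) : ‖x - y‖ ≤ 1 :=
  (norm_sub_le_max x y).trans (max_le hx hy)

lemma exists_norm_minor_eq_one {g : Matrix (Fin 4) (Fin 4) L} (hg : ∀ i j, ‖g i j‖ ≤ 1)
    (hdet : ‖g.det‖ = 1) : ∃ i j, ‖g 2 i * g 3 j - g 2 j * g 3 i‖ = 1 := by
  by_contra! hne
  have hm : ∀ (a b : Fin 4) i j, ‖g a i * g b j - g a j * g b i‖ ≤ 1 := fun a b i j =>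
    norm_sub_le_one (norm_mul_le_one (hg _ _) (hg _ _)) (norm_mul_le_one (hg _ _) (hg _ _))
  have hlt : ∀ a b i j i' j',
      ‖(g a i * g b j - g a j * g b i) * (g 2 i' * g 3 j' - g 2 j' * g 3 i')‖ < 1 :=
    fun a b i j i' j' =>
      norm_mul_lt_one_of_le_of_lt (hm a b i j) ((hm 2 3 i' j').lt_of_ne (hne i' j'))
  have h : ‖g.det‖ < 1 := by
    rw [det_fin_four_laplace]
    exact norm_add_lt_one (norm_sub_lt_one (norm_add_lt_one (norm_add_lt_one (norm_sub_lt_one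
      (hlt ..) (hlt ..)) (hlt ..)) (hlt ..)) (hlt ..)) (hlt ..)
  exact h.ne hdet

lemma Iprime_norm_diag {σ : L ≃+* L} {k : Matrix (Fin 4) (Fin 4) L} (hk : k ∈ Iprime p L σ) :
    ‖k 2 2‖ = 1 ∧ ‖k 3 3‖ = 1 := by
  obtain ⟨⟨⟨-, hint, hdet⟩, -⟩, -, h20, h21, h30, h31, h32⟩ := hk
  obtain ⟨i, j, hij⟩ := exists_norm_minor_eq_one hint hdet
  have hcol : ∀ a b, ‖k 2 a‖ < 1 → ‖k 3 a‖ < 1 →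
      ‖k 2 a * k 3 b - k 2 b * k 3 a‖ < 1 ∧ ‖k 2 b * k 3 a - k 2 a * k 3 b‖ < 1 :=
    fun a b h2 h3 =>
      ⟨norm_sub_lt_one (norm_mul_lt_one_of_lt_of_le h2 (hint _ _))
        (norm_mul_lt_one_of_le_of_lt (hint _ _) h3),
       norm_sub_lt_one (norm_mul_lt_one_of_le_of_lt (hint _ _) h3)
        (norm_mul_lt_one_of_lt_of_le h2 (hint _ _))⟩
  have h22 : ¬ ‖k 2 2‖ < 1 ∧ ¬ ‖k 3 3‖ < 1 := by
    suffices h : ∀ x y : Fin 4, (‖k 2 2‖ < 1 ∨ ‖k 3 3‖ < 1) →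
        ‖k 2 x * k 3 y - k 2 y * k 3 x‖ < 1 from
      not_or.mp fun hlt => (h i j hlt).ne hij
    intro x y hlt
    have h23 : ‖k 2 2 * k 3 3‖ < 1 := hlt.elim
      (fun h => norm_mul_lt_one_of_lt_of_le h (hint _ _))
      (fun h => norm_mul_lt_one_of_le_of_lt (hint _ _) h)
    have h32' : ‖k 2 3 * k 3 2‖ < 1 := norm_mul_lt_one_of_le_of_lt (hint _ _) h32
    fin_cases x <;> fin_cases y
    any_goals exact (hcol 0 _ h20 h30).1
    any_goals exact (hcol 0 _ h20 h30).2
    any_goals exact (hcol 1 _ h21 h31).1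
    any_goals exact (hcol 1 _ h21 h31).2
    · simp
    · exact norm_sub_lt_one h23 h32'
    · exact norm_sub_lt_one h32' h23
    · simp
  exact ⟨(hint 2 2).antisymm (not_lt.mp h22.1), (hint 3 3).antisymm (not_lt.mp h22.2)⟩

lemma PIprime_norm_lt {σ : L ≃+* L} {x : Matrix (Fin 4) (Fin 4) L} (hx : x ∈ PIprime p L σ) :
    ‖x 2 0‖ < ‖x 2 2‖ ∧ ‖x 2 1‖ < ‖x 2 2‖ := by
  obtain ⟨q, hq, k, hk, rfl⟩ := hx
  obtain ⟨r, hr, hrow⟩ := Ptilde_mul_row hq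
  have hr' : 0 < ‖r‖ := norm_pos_iff.mpr hr
  have h22 := (Iprime_norm_diag hk).1
  obtain ⟨-, -, h20, h21, -⟩ := hk
  simp only [hrow, norm_mul, h22]
  exact ⟨mul_lt_mul_of_pos_left h20 hr', mul_lt_mul_of_pos_left h21 hr'⟩

lemma Ps1Iprime_norm_lt {σ : L ≃+* L} {x : Matrix (Fin 4) (Fin 4) L}
    (hx : x ∈ Ps1Iprime p L σ) : ‖x 2 0‖ < ‖x 2 3‖ ∧ ‖x 2 1‖ < ‖x 2 3‖ := by
  obtain ⟨q, hq, k, hk, rfl⟩ := hx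
  obtain ⟨r, hr, hrow⟩ := Ptilde_mul_row hq
  have hr' : 0 < ‖r‖ := norm_pos_iff.mpr hr
  have h33 := (Iprime_norm_diag hk).2
  obtain ⟨-, -, -, -, h30, h31, -⟩ := hk
  have hs : ∀ j, (s1L L * k) 2 j = k 3 j := fun j => by
    simp [s1L, Matrix.mul_apply, Fin.sum_univ_four]
  simp only [Matrix.mul_assoc, hrow, hs, norm_mul, h33]
  exact ⟨mul_lt_mul_of_pos_left h30 hr', mul_lt_mul_of_pos_left h31 hr'⟩

/-- The third row of `x` is proportional to an integral vector with a unit entry whose reduction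
is fixed by conjugation. -/
def HasRationalRow (σ : L ≃+* L) (x : Matrix (Fin 4) (Fin 4) L) : Prop :=
  ∃ (r : L) (w : Fin 4 → L), (∀ j, ‖w j‖ ≤ 1) ∧ (∀ j, ‖w j - σ (w j)‖ < 1) ∧
    (∃ j, ‖w j‖ = 1) ∧ ∀ j, x 2 j = r * w j

lemma Kprime_norm_sub_conj_lt {σ : L ≃+* L}
    (hσ : ∀ x : ℚ_[p], σ (algebraMap ℚ_[p] L x) = algebraMap ℚ_[p] L x)
    (hiso : ∀ x, ‖σ x‖ = ‖x‖)
    {k : Matrix (Fin 4) (Fin 4) L} (hk : k ∈ Kprime p L σ) (i j) :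
    ‖k i j - σ (k i j)‖ < 1 := by
  obtain ⟨u, -, hu⟩ := hk.2 i j
  have h : k i j - σ (k i j) = (k i j - algebraMap ℚ_[p] L u)
      - σ (k i j - algebraMap ℚ_[p] L u) := by rw [map_sub, hσ]; ring
  rw [h]
  exact norm_sub_lt_one hu (by rwa [hiso])

lemma hasRationalRow_of_PKprime {σ : L ≃+* L}
    (hσ : ∀ x : ℚ_[p], σ (algebraMap ℚ_[p] L x) = algebraMap ℚ_[p] L x)
    (hiso : ∀ x, ‖σ x‖ = ‖x‖)
    {x : Matrix (Fin 4) (Fin 4) L} (hx : x ∈ PKprime p L σ) :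
    HasRationalRow σ x := by
  obtain ⟨q, hq, k, hk, rfl⟩ := hx
  obtain ⟨r, hr, hrow⟩ := Ptilde_mul_row hq
  refine ⟨r, fun j => k 2 j, fun j => hk.1.2.1 _ _,
    fun j => Kprime_norm_sub_conj_lt hσ hiso hk _ _, ?_, hrow k⟩
  obtain ⟨i, j, hij⟩ := exists_norm_minor_eq_one hk.1.2.1 hk.1.2.2
  by_contra! hne
  have hlt : ∀ j, ‖k 2 j‖ < 1 := fun j => (hk.1.2.1 _ _).lt_of_ne (hne j)
  exact (norm_sub_lt_one (norm_mul_lt_one_of_lt_of_le (hlt i) (hk.1.2.1 _ _))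
    (norm_mul_lt_one_of_lt_of_le (hlt j) (hk.1.2.1 _ _))).ne hij

lemma hasRationalRow_of_PIprime {σ : L ≃+* L}
    (hσ : ∀ x : ℚ_[p], σ (algebraMap ℚ_[p] L x) = algebraMap ℚ_[p] L x)
    (hiso : ∀ x, ‖σ x‖ = ‖x‖)
    {x : Matrix (Fin 4) (Fin 4) L} (hx : x ∈ PIprime p L σ) :
    HasRationalRow σ x := by
  obtain ⟨q, hq, k, hk, rfl⟩ := hx
  exact hasRationalRow_of_PKprime hσ hiso ⟨q, hq, k, hk.1, rfl⟩

lemma hasRationalRow_of_Ps1Iprime {σ : L ≃+* L}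
    (hσ : ∀ x : ℚ_[p], σ (algebraMap ℚ_[p] L x) = algebraMap ℚ_[p] L x)
    (hiso : ∀ x, ‖σ x‖ = ‖x‖)
    {x : Matrix (Fin 4) (Fin 4) L} (hx : x ∈ Ps1Iprime p L σ) :
    HasRationalRow σ x := by
  obtain ⟨q, hq, k, hk, rfl⟩ := hx
  obtain ⟨r, hr, hrow⟩ := Ptilde_mul_row hq
  refine ⟨r, fun j => k 3 j, fun j => hk.1.1.2.1 _ _,
    fun j => Kprime_norm_sub_conj_lt hσ hiso hk.1 _ _, ⟨3, (Iprime_norm_diag hk).2⟩, fun j => ?_⟩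
  rw [Matrix.mul_assoc, hrow]
  simp [s1L, Matrix.mul_apply, Fin.sum_univ_four]

lemma not_hasRationalRow_of_PThetaKprime {σ : L ≃+* L}
    (hσ : ∀ x : ℚ_[p], σ (algebraMap ℚ_[p] L x) = algebraMap ℚ_[p] L x)
    (hiso : ∀ x, ‖σ x‖ = ‖x‖)
    {sqd : L} {b c : ℚ_[p]} {α : L}
    (hα : α = (algebraMap ℚ_[p] L b + sqd) / (2 * algebraMap ℚ_[p] L c))
    (hαn : ‖α‖ ≤ 1) (hαα : ‖σ α - α‖ = 1) (hinv : σ (σ α) = α)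
    {x : Matrix (Fin 4) (Fin 4) L} (hx : x ∈ PThetaKprime p L σ sqd b c) :
    ¬ HasRationalRow σ x := by
  rintro ⟨r, w, hw, hwσ, ⟨i₀, hi₀⟩, hrw⟩
  obtain ⟨q, hq, k, hk, rfl⟩ := hx
  obtain ⟨s, hs, hrow⟩ := Ptilde_mul_row hq
  set v : Fin 4 → L := fun j => k 2 j - σ α * k 3 j with hv
  have hint := hk.1.2.1
  have hvw : ∀ j, v j = (r / s) * w j := by
    intro j
    have h := hrw j
    rw [Matrix.mul_assoc, hrow] at h
    have hθ : (Theta p L σ sqd b c * k) 2 j = v j := by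
      simp [Theta, ← hα, Matrix.mul_apply, Fin.sum_univ_four, hv]
      ring
    rw [hθ] at h
    rw [div_mul_eq_mul_div, ← h, mul_div_cancel_left₀ _ hs]
  have hσα : ‖σ α‖ ≤ 1 := by rwa [hiso]
  have hvn : ∀ j, ‖v j‖ ≤ 1 := fun j =>
    norm_sub_le_one (hint _ _) (norm_mul_le_one hσα (hint _ _))
  have hrs : ‖r / s‖ ≤ 1 := by
    have := hvn i₀
    rwa [hvw, norm_mul, hi₀, mul_one] at this
  have hsmall : ∀ i j, ‖v i * σ (v j) - v j * σ (v i)‖ < 1 := by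
    intro i j
    have e : v i * σ (v j) - v j * σ (v i) = (r / s * σ (r / s)) *
        (w j * (w i - σ (w i)) - w i * (w j - σ (w j))) := by
      rw [hvw, hvw, map_mul, map_mul]; ring
    rw [e]
    exact norm_mul_lt_one_of_le_of_lt (norm_mul_le_one hrs (by rwa [hiso]))
      (norm_sub_lt_one (norm_mul_lt_one_of_le_of_lt (hw _) (hwσ _))
        (norm_mul_lt_one_of_le_of_lt (hw _) (hwσ _)))
  obtain ⟨i, j, hij⟩ := exists_norm_minor_eq_one hint hk.1.2.2
  have hε := fun a b => Kprime_norm_sub_conj_lt hσ hiso hk a b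
  have hfix : ∀ l, ‖σ (v l) - (k 2 l - α * k 3 l)‖ < 1 := by
    intro l
    have e : σ (v l) - (k 2 l - α * k 3 l)
        = α * (k 3 l - σ (k 3 l)) - (k 2 l - σ (k 2 l)) := by
      simp only [hv, map_sub, map_mul, hinv]; ring
    rw [e]
    exact norm_sub_lt_one (norm_mul_lt_one_of_le_of_lt hαn (hε _ _)) (hε _ _)
  have e : (σ α - α) * (k 2 i * k 3 j - k 2 j * k 3 i)
      = (v i * σ (v j) - v j * σ (v i))
        - (v i * (σ (v j) - (k 2 j - α * k 3 j)) - v j * (σ (v i) - (k 2 i - α * k 3 i))) := by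
    simp only [hv]; ring
  have hlt : ‖(σ α - α) * (k 2 i * k 3 j - k 2 j * k 3 i)‖ < 1 := by
    rw [e]
    exact norm_sub_lt_one (hsmall i j)
      (norm_sub_lt_one (norm_mul_lt_one_of_le_of_lt (hvn _) (hfix _))
        (norm_mul_lt_one_of_le_of_lt (hvn _) (hfix _)))
  rw [norm_mul, hαα, hij, one_mul] at hlt
  exact lt_irrefl _ hlt

lemma mem_Iprime_of_norm_sub_one_lt {σ : L ≃+* L} {k : Matrix (Fin 4) (Fin 4) L} (hk : k ∈ GU p L σ)
    (hdet : k.det = 1) (hone : ∀ i j, ‖k i j - (1 : Matrix (Fin 4) (Fin 4) L) i j‖ < 1) :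
    k ∈ Iprime p L σ := by
  have hoff : ∀ i j, i ≠ j → ‖k i j‖ < 1 := fun i j hij => by simpa [hij] using hone i j
  refine ⟨⟨⟨hk, fun i j => ?_, by simp [hdet]⟩, fun i j => ?_⟩, ?_, ?_, ?_, ?_, ?_, ?_⟩
  · have h1 : ‖(1 : Matrix (Fin 4) (Fin 4) L) i j‖ ≤ 1 := by
      rw [one_apply]; split_ifs <;> simp
    have h := IsUltrametricDist.norm_add_le_max
      (k i j - (1 : Matrix (Fin 4) (Fin 4) L) i j) ((1 : Matrix (Fin 4) (Fin 4) L) i j)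
    rw [sub_add_cancel] at h
    exact h.trans (max_le (hone i j).le h1)
  · refine ⟨if i = j then 1 else 0, by split_ifs <;> simp, ?_⟩
    have h := hone i j
    rw [one_apply] at h
    split_ifs with hij <;> simpa [hij] using h
  all_goals exact hoff _ _ (by decide)

end Ultrametric

lemma mapL_mul (g h : Matrix (Fin 4) (Fin 4) ℚ_[p]) :
    mapL p L (g * h) = mapL p L g * mapL p L h := Matrix.map_mul

lemma mapL_mem_Kprime {σ : L ≃+* L}
    (hσ : ∀ x : ℚ_[p], σ (algebraMap ℚ_[p] L x) = algebraMap ℚ_[p] L x)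
    (hn : ∀ x : ℚ_[p], ‖algebraMap ℚ_[p] L x‖ = ‖x‖)
    {g : Matrix (Fin 4) (Fin 4) ℚ_[p]} (hg : g ∈ Kp p) : mapL p L g ∈ Kprime p L σ := by
  obtain ⟨hg, hint, hdet⟩ := hg
  refine ⟨⟨mapL_mem_GU hσ hg, fun i j => ?_, ?_⟩, fun i j => ⟨g i j, hint i j, ?_⟩⟩
  · simpa [mapL, hn] using hint i j
  · have h : (mapL p L g).det = algebraMap ℚ_[p] L g.det := (RingHom.map_det _ _).symm
    rw [h, hn, hdet]
  · simp [mapL]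

lemma hmat_mem_GSp4 (l : ℤ) (m : ℕ) : hmat p l m ∈ GSp4 p := by
  have hp : (p : ℚ_[p]) ≠ 0 := Nat.cast_ne_zero.mpr (Fact.out : p.Prime).ne_zero
  refine ⟨?_, Units.mk0 ((p : ℚ_[p]) ^ (2 * (m : ℤ) + l)) (zpow_ne_zero _ hp), ?_⟩
  · simp [hmat, Fin.prod_univ_four, hp, zpow_ne_zero]
  · have h : (p : ℚ_[p]) ^ ((m : ℤ) + l) * (p : ℚ_[p]) ^ m = (p : ℚ_[p]) ^ (2 * (m : ℤ) + l) := by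
      rw [← zpow_natCast, ← zpow_add₀ hp]; congr 1; ring
    ext i j
    fin_cases i <;> fin_cases j <;>
      simp [hmat, Jmat, Matrix.mul_apply, Fin.sum_univ_four, h, mul_comm ((p : ℚ_[p]) ^ m)]

lemma GSp4_mul {g h : Matrix (Fin 4) (Fin 4) ℚ_[p]} (hg : g ∈ GSp4 p) (hh : h ∈ GSp4 p) :
    g * h ∈ GSp4 p := by
  obtain ⟨hgd, μ, hg⟩ := hg
  obtain ⟨hhd, ν, hh⟩ := hh
  refine ⟨by rw [det_mul]; exact hgd.mul hhd, μ * ν, ?_⟩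
  calc (g * h)ᵀ * Jmat p * (g * h) = hᵀ * (gᵀ * Jmat p * g) * h := by
        rw [transpose_mul]; simp only [Matrix.mul_assoc]
    _ = ((μ * ν : ℚ_[p]ˣ) : ℚ_[p]) • Jmat p := by
        rw [hg, Matrix.mul_smul, Matrix.smul_mul, hh, smul_smul, Units.val_mul]

lemma t1_eq : t1 p = !![-1,0,0,0; 0,-1,0,0; 1,0,-1,0; 0,0,0,-1] := by
  ext i j
  fin_cases i <;> fin_cases j <;>
    simp [t1, Jmat, Umat, Zmat, Matrix.mul_apply, Fin.sum_univ_four]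

lemma t2_eq : t2 p = !![0,-1,0,0; -1,0,0,0; 0,1,0,-1; 0,0,-1,0] := by
  ext i j
  fin_cases i <;> fin_cases j <;>
    simp [t2, Jmat, Umat, Zinf, Matrix.mul_apply, Fin.sum_univ_four]

lemma t7_eq : t7 p = !![0,0,1,0; 0,0,0,1; -1,0,0,0; 0,-1,0,0] := by
  ext i j
  fin_cases i <;> fin_cases j <;>
    simp [t7, Jmat, Umat, Zmat, Matrix.mul_apply, Fin.sum_univ_four]

lemma t8_eq : t8 p = !![0,0,0,1; 0,0,1,0; 0,-1,0,0; -1,0,0,0] := by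
  ext i j
  fin_cases i <;> fin_cases j <;>
    simp [t8, Jmat, Umat, Zinf, Matrix.mul_apply, Fin.sum_univ_four]

variable (p) in
/-- The common shape of `t₃ = lowerMat 1` and `t₅ = lowerMat 0`. -/
def lowerMat (e : ℚ_[p]) : Matrix (Fin 4) (Fin 4) ℚ_[p] :=
  !![-1,0,0,0; 0,-1,0,0; 0,0,-1,0; 0,e,0,-1]

lemma t3_eq : t3 p = lowerMat p 1 := by
  ext i j
  fin_cases i <;> fin_cases j <;>
    simp [t3, lowerMat, Jmat, Umat, Zmat, Matrix.mul_apply, Fin.sum_univ_four]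

lemma t5_eq : t5 p = lowerMat p 0 := by
  ext i j
  fin_cases i <;> fin_cases j <;>
    simp [t5, lowerMat, Jmat, Umat, Zmat, Matrix.mul_apply, Fin.sum_univ_four]

lemma Zmat_zero : Zmat p 0 = 1 := by
  ext i j
  fin_cases i <;> fin_cases j <;> simp [Zmat]

lemma t4_eq : t4 p = lowerMat p 1 * Zinf p := by
  rw [← t3_eq, t3, t4, Zmat_zero, Matrix.mul_one]

lemma t6_eq : t6 p = lowerMat p 0 * Zinf p := by
  rw [← t5_eq, t5, t6, Zmat_zero, Matrix.mul_one]

lemma mapL_Zinf : mapL p L (Zinf p) = s1L L := by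
  ext i j
  fin_cases i <;> fin_cases j <;> simp [mapL, Zinf, s1L]

/-- A symplectic matrix with entries of norm at most one lies in `GSp₄(ℤ_p)`. -/
lemma mem_Kp_of_symplectic {g : Matrix (Fin 4) (Fin 4) ℚ_[p]} (hg : gᵀ * Jmat p * g = Jmat p)
    (hdet : ‖g.det‖ = 1) (hint : ∀ i j, ‖g i j‖ ≤ 1) : g ∈ Kp p :=
  ⟨⟨(norm_ne_zero_iff.mp (by rw [hdet]; exact one_ne_zero)).isUnit, 1, by simpa using hg⟩,
    hint, hdet⟩

lemma lowerMat_mem_Kp {e : ℚ_[p]} (he : ‖e‖ ≤ 1) : lowerMat p e ∈ Kp p := by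
  refine mem_Kp_of_symplectic ?_ ?_ fun i j => ?_
  · ext i j
    fin_cases i <;> fin_cases j <;>
      simp [lowerMat, Jmat, Matrix.mul_apply, Fin.sum_univ_four]
  · simp [det_fin_four_laplace, lowerMat]
  · fin_cases i <;> fin_cases j <;> simp [lowerMat, he]

lemma t1_mem_Kp : t1 p ∈ Kp p := by
  rw [t1_eq]
  refine mem_Kp_of_symplectic ?_ ?_ fun i j => ?_
  · ext i j
    fin_cases i <;> fin_cases j <;> simp [Jmat, Matrix.mul_apply, Fin.sum_univ_four]
  · simp [det_fin_four_laplace]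
  · fin_cases i <;> fin_cases j <;> simp

lemma t2_mem_Kp : t2 p ∈ Kp p := by
  rw [t2_eq]
  refine mem_Kp_of_symplectic ?_ ?_ fun i j => ?_
  · ext i j
    fin_cases i <;> fin_cases j <;> simp [Jmat, Matrix.mul_apply, Fin.sum_univ_four]
  · simp [det_fin_four_laplace]
  · fin_cases i <;> fin_cases j <;> simp

lemma t7_mem_Kp : t7 p ∈ Kp p := by
  rw [t7_eq]
  refine mem_Kp_of_symplectic ?_ ?_ fun i j => ?_
  · ext i j
    fin_cases i <;> fin_cases j <;> simp [Jmat, Matrix.mul_apply, Fin.sum_univ_four]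
  · simp [det_fin_four_laplace]
  · fin_cases i <;> fin_cases j <;> simp

lemma Theta_hmat_row {σ : L ≃+* L} {sqd α : L} {b c : ℚ_[p]}
    (hα : α = (algebraMap ℚ_[p] L b + sqd) / (2 * algebraMap ℚ_[p] L c))
    (l : ℤ) (m : ℕ) (t : Matrix (Fin 4) (Fin 4) ℚ_[p]) (j : Fin 4) :
    (Theta p L σ sqd b c * mapL p L (hmat p l m * t)) 2 j =
      algebraMap ℚ_[p] L (t 2 j)
        - σ α * algebraMap ℚ_[p] L (p ^ m) * algebraMap ℚ_[p] L (t 3 j) := by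
  simp [Theta, ← hα, mapL, hmat, Matrix.mul_apply, Fin.sum_univ_four, diagonal_apply]
  ring

lemma Theta_hmat_zero_mem {σ : L ≃+* L} {sqd : L} {b c : ℚ_[p]}
    (hσ : ∀ x : ℚ_[p], σ (algebraMap ℚ_[p] L x) = algebraMap ℚ_[p] L x)
    (hn : ∀ x : ℚ_[p], ‖algebraMap ℚ_[p] L x‖ = ‖x‖) (l : ℤ)
    {t : Matrix (Fin 4) (Fin 4) ℚ_[p]} (ht : t ∈ Kp p) :
    Theta p L σ sqd b c * mapL p L (hmat p l 0 * t) ∈ PThetaKprime p L σ sqd b c := by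
  refine ⟨mapL p L (hmat p l 0), ⟨mapL_mem_GU hσ (hmat_mem_GSp4 l 0), ?_, ?_, ?_⟩, mapL p L t,
    mapL_mem_Kprime hσ hn ht, ?_⟩
  · simp [mapL, hmat]
  · simp [mapL, hmat]
  · simp [mapL, hmat]
  · rw [mapL_mul, ← Matrix.mul_assoc]
    congr 1
    ext i j
    fin_cases i <;> fin_cases j <;>
      simp [mapL, hmat, Theta, Matrix.mul_apply, Fin.sum_univ_four, mul_comm]

/-- The conjugate of `Θ` by `h(l,m)·lowerMat e`, with `β = α p^m`. -/
def conjTheta (σ : L ≃+* L) (e β : L) : Matrix (Fin 4) (Fin 4) L :=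
  !![1,0,0,0; β,1,0,0; 0,e * σ β,1,-σ β; e * β,0,0,1]

/-- The conjugate of `conjTheta` by `s₁`. -/
def conjThetaSwap (σ : L ≃+* L) (e β : L) : Matrix (Fin 4) (Fin 4) L :=
  !![1,β,0,0; 0,1,0,0; 0,e * β,1,0; e * σ β,0,-σ β,1]

lemma conjTheta_mul_s1L (σ : L ≃+* L) (e β : L) :
    conjTheta σ e β * s1L L = s1L L * conjThetaSwap σ e β := by
  ext i j
  fin_cases i <;> fin_cases j <;>
    simp [conjTheta, conjThetaSwap, s1L, Matrix.mul_apply, Fin.sum_univ_four]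

lemma conjTheta_mem_Iprime [IsUltrametricDist L] {σ : L ≃+* L} (hiso : ∀ x, ‖σ x‖ = ‖x‖)
    {e β : L} (he : ‖e‖ ≤ 1) (hσe : σ e = e) (hβ : ‖β‖ < 1) (hinv : σ (σ β) = β) :
    conjTheta σ e β ∈ Iprime p L σ ∧ conjThetaSwap σ e β ∈ Iprime p L σ := by
  have hσβ : ‖σ β‖ < 1 := by rwa [hiso]
  have h1 : ‖e‖ * ‖β‖ < 1 := by simpa using norm_mul_lt_one_of_le_of_lt he hβ
  refine ⟨mem_Iprime_of_norm_sub_one_lt ⟨1, one_ne_zero, ?_⟩ ?_ fun i j => ?_,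
    mem_Iprime_of_norm_sub_one_lt ⟨1, one_ne_zero, ?_⟩ ?_ fun i j => ?_⟩
  · ext i j
    fin_cases i <;> fin_cases j <;>
      simp [conjTheta, JmatL, Matrix.mul_apply, Fin.sum_univ_four, hσe, hinv]
    ring
  · simp [det_fin_four_laplace, conjTheta]
  · fin_cases i <;> fin_cases j <;> simp [conjTheta, hiso, hβ, h1]
  · ext i j
    fin_cases i <;> fin_cases j <;>
      simp [conjThetaSwap, JmatL, Matrix.mul_apply, Fin.sum_univ_four, hσe, hinv]
    ring
  · simp [det_fin_four_laplace, conjThetaSwap]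
  · fin_cases i <;> fin_cases j <;> simp [conjThetaSwap, hiso, hβ, h1]

lemma Theta_mul_hmat_lowerMat {σ : L ≃+* L} {sqd α : L} {b c : ℚ_[p]}
    (hα : α = (algebraMap ℚ_[p] L b + sqd) / (2 * algebraMap ℚ_[p] L c))
    (l : ℤ) (m : ℕ) (e : ℚ_[p]) :
    Theta p L σ sqd b c * mapL p L (hmat p l m * lowerMat p e) =
      mapL p L (hmat p l m * lowerMat p e) *
        conjTheta σ (algebraMap ℚ_[p] L e) (α * algebraMap ℚ_[p] L (p ^ m)) := by
  have hp : (p : L) ≠ 0 := by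
    rw [← map_natCast (algebraMap ℚ_[p] L)]
    exact (map_ne_zero _).mpr (Nat.cast_ne_zero.mpr (Fact.out : p.Prime).ne_zero)
  have h : (p : L) ^ (2 * (m : ℤ) + l) = (p : L) ^ ((m : ℤ) + l) * (p : L) ^ m := by
    rw [← zpow_natCast, ← zpow_add₀ hp]; congr 1; ring
  ext i j
  fin_cases i <;> fin_cases j <;>
    simp [mapL, hmat, lowerMat, Theta, ← hα, conjTheta, Matrix.mul_apply, Fin.sum_univ_four]
  · rw [h]; ring
  · ring
  · ring

lemma hmat_lowerMat_mem_Ptilde {σ : L ≃+* L}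
    (hσ : ∀ x : ℚ_[p], σ (algebraMap ℚ_[p] L x) = algebraMap ℚ_[p] L x)
    (l : ℤ) (m : ℕ) {e : ℚ_[p]} (he : ‖e‖ ≤ 1) :
    mapL p L (hmat p l m * lowerMat p e) ∈ Ptilde p L σ := by
  refine ⟨mapL_mem_GU hσ (GSp4_mul (hmat_mem_GSp4 l m) (lowerMat_mem_Kp he).1), ?_, ?_, ?_⟩ <;>
    simp [mapL, hmat, lowerMat]

/-- The norm and conjugation properties of `α` that govern the position of `Θ`. -/
lemma alpha_spec {σ : L ≃+* L} {sqd α : L} {a b c : ℚ_[p]}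
    (hα : α = (algebraMap ℚ_[p] L b + sqd) / (2 * algebraMap ℚ_[p] L c))
    (hσ : ∀ x : ℚ_[p], σ (algebraMap ℚ_[p] L x) = algebraMap ℚ_[p] L x)
    (hσsqd : σ sqd = -sqd)
    (hsqd : sqd ^ 2 = algebraMap ℚ_[p] L (b ^ 2 - 4 * a * c))
    (hnorm : ∀ u v : ℚ_[p],
      ‖algebraMap ℚ_[p] L u + algebraMap ℚ_[p] L v * sqd‖ = max ‖u‖ ‖v‖)
    (ha : ‖a‖ = 1) (hb : ‖b‖ ≤ 1) (hc : ‖c‖ = 1) :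
    ‖α‖ = 1 ∧ ‖σ α - α‖ = 1 ∧ σ (σ α) = α := by
  have hn : ∀ x : ℚ_[p], ‖algebraMap ℚ_[p] L x‖ = ‖x‖ := fun x => by simpa using hnorm x 0
  have hs : ‖sqd‖ = 1 := by simpa using hnorm 0 1
  have hbs : ‖algebraMap ℚ_[p] L b + sqd‖ = 1 := by simpa [hb] using hnorm b 1
  have hint2 : ‖(2 : ℚ_[p])‖ ≤ 1 := by simpa using Padic.norm_int_le_one (p := p) 2
  have h2 : ‖(2 : ℚ_[p])‖ = 1 := by
    refine hint2.antisymm ?_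
    have e : (algebraMap ℚ_[p] L b + sqd) ^ 2 = algebraMap ℚ_[p] L 2 *
        (algebraMap ℚ_[p] L (b ^ 2 - 2 * a * c) + algebraMap ℚ_[p] L b * sqd) := by
      have : (algebraMap ℚ_[p] L b + sqd) ^ 2
          = algebraMap ℚ_[p] L b ^ 2 + 2 * algebraMap ℚ_[p] L b * sqd + sqd ^ 2 := by ring
      rw [this, hsqd]
      simp only [map_sub, map_mul, map_pow, map_ofNat]
      ring
    have h := congrArg norm e
    rw [norm_pow, hbs, norm_mul, hn, hnorm, one_pow] at h
    have hle : max ‖b ^ 2 - 2 * a * c‖ ‖b‖ ≤ 1 := by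
      refine max_le (norm_sub_le_one ?_ ?_) hb
      · rw [norm_pow]; exact pow_le_one₀ (norm_nonneg _) hb
      · rw [norm_mul, norm_mul, ha, hc, mul_one, mul_one]; exact hint2
    rw [h]
    exact mul_le_of_le_one_right (norm_nonneg _) hle
  have h2L : ‖(2 : L)‖ = 1 := by
    rw [← map_ofNat (algebraMap ℚ_[p] L) 2, hn, h2]
  have h20 : (2 : L) ≠ 0 := norm_ne_zero_iff.mp (by rw [h2L]; exact one_ne_zero)
  have hcL : algebraMap ℚ_[p] L c ≠ 0 :=
    norm_ne_zero_iff.mp (by rw [hn, hc]; exact one_ne_zero)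
  refine ⟨by simp [hα, hbs, h2L, hn, hc], ?_, ?_⟩
  · have e : σ α - α = -(sqd / algebraMap ℚ_[p] L c) := by
      rw [hα]
      simp only [map_div₀, map_add, map_mul, map_ofNat, hσ, hσsqd]
      field_simp
      ring
    simp [e, hs, hn, hc]
  · simp only [hα, map_div₀, map_add, map_mul, map_ofNat, hσ, hσsqd, map_neg, neg_neg]

end Helpers

theorem theta_h_t_membership_Iprime
    (σ : L ≃+* L) (sqd : L) (a b c : ℚ_[p])
    (hσalg : ∀ x : ℚ_[p], σ (algebraMap ℚ_[p] L x) = algebraMap ℚ_[p] L x)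
    (hσsqd : σ sqd = -sqd)
    (hsqd : sqd ^ 2 = algebraMap ℚ_[p] L (b ^ 2 - 4 * a * c))
    (hspan : ∀ x : L, ∃ u v : ℚ_[p],
      x = algebraMap ℚ_[p] L u + algebraMap ℚ_[p] L v * sqd)
    (hnorm : ∀ u v : ℚ_[p],
      ‖algebraMap ℚ_[p] L u + algebraMap ℚ_[p] L v * sqd‖ = max ‖u‖ ‖v‖)
    (ha : ‖a‖ = 1) (hb : ‖b‖ ≤ 1) (hc : ‖c‖ = 1)
    (hd : ‖b ^ 2 - 4 * a * c‖ = 1)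
    (hnsq : ∀ z : ℚ_[p], z ^ 2 ≠ b ^ 2 - 4 * a * c) :
    (PKprime p L σ ∩ PThetaKprime p L σ sqd b c = ∅) ∧
    (∀ (l : ℤ) (m : ℕ), 0 < m →
      (Theta p L σ sqd b c * mapL p L (hmat p l m * t3 p) ∈ PIprime p L σ ∧
       Theta p L σ sqd b c * mapL p L (hmat p l m * t5 p) ∈ PIprime p L σ) ∧
      (Theta p L σ sqd b c * mapL p L (hmat p l m * t4 p) ∈ Ps1Iprime p L σ ∧
       Theta p L σ sqd b c * mapL p L (hmat p l m * t6 p) ∈ Ps1Iprime p L σ) ∧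
      (Theta p L σ sqd b c * mapL p L (hmat p l m * t1 p) ∉ PIprime p L σ ∧
       Theta p L σ sqd b c * mapL p L (hmat p l m * t1 p) ∉ Ps1Iprime p L σ ∧
       Theta p L σ sqd b c * mapL p L (hmat p l m * t2 p) ∉ PIprime p L σ ∧
       Theta p L σ sqd b c * mapL p L (hmat p l m * t2 p) ∉ Ps1Iprime p L σ ∧
       Theta p L σ sqd b c * mapL p L (hmat p l m * t7 p) ∉ PIprime p L σ ∧
       Theta p L σ sqd b c * mapL p L (hmat p l m * t7 p) ∉ Ps1Iprime p L σ ∧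
       Theta p L σ sqd b c * mapL p L (hmat p l m * t8 p) ∉ PIprime p L σ ∧
       Theta p L σ sqd b c * mapL p L (hmat p l m * t8 p) ∉ Ps1Iprime p L σ)) ∧
    (∀ l : ℤ,
      (Theta p L σ sqd b c * mapL p L (hmat p l 0 * t1 p) ∈ PThetaKprime p L σ sqd b c ∧
       Theta p L σ sqd b c * mapL p L (hmat p l 0 * t2 p) ∈ PThetaKprime p L σ sqd b c ∧
       Theta p L σ sqd b c * mapL p L (hmat p l 0 * t5 p) ∈ PThetaKprime p L σ sqd b c ∧
       Theta p L σ sqd b c * mapL p L (hmat p l 0 * t7 p) ∈ PThetaKprime p L σ sqd b c) ∧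
      (Theta p L σ sqd b c * mapL p L (hmat p l 0 * t1 p) ∉ PIprime p L σ ∧
       Theta p L σ sqd b c * mapL p L (hmat p l 0 * t1 p) ∉ Ps1Iprime p L σ ∧
       Theta p L σ sqd b c * mapL p L (hmat p l 0 * t2 p) ∉ PIprime p L σ ∧
       Theta p L σ sqd b c * mapL p L (hmat p l 0 * t2 p) ∉ Ps1Iprime p L σ ∧
       Theta p L σ sqd b c * mapL p L (hmat p l 0 * t5 p) ∉ PIprime p L σ ∧
       Theta p L σ sqd b c * mapL p L (hmat p l 0 * t5 p) ∉ Ps1Iprime p L σ ∧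
       Theta p L σ sqd b c * mapL p L (hmat p l 0 * t7 p) ∉ PIprime p L σ ∧
       Theta p L σ sqd b c * mapL p L (hmat p l 0 * t7 p) ∉ Ps1Iprime p L σ)) := by
  have hn : ∀ x : ℚ_[p], ‖algebraMap ℚ_[p] L x‖ = ‖x‖ := fun x => by simpa using hnorm x 0
  have : IsUltrametricDist L := by
    refine IsUltrametricDist.isUltrametricDist_of_forall_norm_add_le_max_norm fun x y => ?_
    obtain ⟨u, v, rfl⟩ := hspan x
    obtain ⟨u', v', rfl⟩ := hspan y
    have e : algebraMap ℚ_[p] L u + algebraMap ℚ_[p] L v * sqd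
        + (algebraMap ℚ_[p] L u' + algebraMap ℚ_[p] L v' * sqd)
        = algebraMap ℚ_[p] L (u + u') + algebraMap ℚ_[p] L (v + v') * sqd := by
      simp only [map_add]; ring
    rw [e, hnorm, hnorm, hnorm]
    exact (max_le_max (Padic.nonarchimedean _ _) (Padic.nonarchimedean _ _)).trans_eq
      (max_max_max_comm _ _ _ _)
  have hiso : ∀ x, ‖σ x‖ = ‖x‖ := by
    intro x
    obtain ⟨u, v, rfl⟩ := hspan x
    have h := hnorm u (-v)
    rw [norm_neg, ← hnorm u v] at h
    rw [← h, map_add, map_mul, hσalg, hσalg, hσsqd]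
    simp
  obtain ⟨α, hα⟩ : ∃ α, α = (algebraMap ℚ_[p] L b + sqd) / (2 * algebraMap ℚ_[p] L c) := ⟨_, rfl⟩
  obtain ⟨hαn, hαα, hinv⟩ := alpha_spec hα hσalg hσsqd hsqd hnorm ha hb hc
  have hrow := Theta_hmat_row (σ := σ) hα
  have hirr : ∀ x ∈ PThetaKprime p L σ sqd b c, ¬ HasRationalRow σ x := fun x =>
    not_hasRationalRow_of_PThetaKprime hσalg hiso hα hαn.le hαα hinv
  have hpm : ∀ m : ℕ, ‖(p : L) ^ m‖ ≤ 1 := fun m => by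
    have h := hn ((p : ℚ_[p]) ^ m)
    rw [map_pow, map_natCast] at h
    rw [h, norm_pow]
    exact pow_le_one₀ (norm_nonneg _) Padic.norm_p_lt_one.le
  have hmem : ∀ (l : ℤ) (m : ℕ), 0 < m → ∀ e : ℚ_[p], ‖e‖ ≤ 1 →
      Theta p L σ sqd b c * mapL p L (hmat p l m * lowerMat p e) ∈ PIprime p L σ ∧
      Theta p L σ sqd b c * mapL p L (hmat p l m * (lowerMat p e * Zinf p))
        ∈ Ps1Iprime p L σ := by
    intro l m hm e he
    have hβ : ‖α * algebraMap ℚ_[p] L (p ^ m)‖ < 1 := by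
      rw [norm_mul, hαn, one_mul, hn, norm_pow]
      exact pow_lt_one₀ (norm_nonneg _) Padic.norm_p_lt_one hm.ne'
    obtain ⟨hk, hk'⟩ := conjTheta_mem_Iprime (p := p) hiso (e := algebraMap ℚ_[p] L e)
      (by rwa [hn]) (hσalg e) hβ (by rw [map_mul, map_mul, hinv, hσalg, hσalg])
    have hP := hmat_lowerMat_mem_Ptilde hσalg l m he
    have hΘ := Theta_mul_hmat_lowerMat (σ := σ) hα l m e
    refine ⟨⟨_, hP, _, hk, hΘ⟩, ⟨_, hP, _, hk', ?_⟩⟩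
    rw [← Matrix.mul_assoc, mapL_mul, mapL_Zinf, ← Matrix.mul_assoc, hΘ, Matrix.mul_assoc,
      conjTheta_mul_s1L, ← Matrix.mul_assoc]
  have hnotmem : ∀ x : Matrix (Fin 4) (Fin 4) L,
      (‖x 2 2‖ ≤ ‖x 2 0‖ ∧ ‖x 2 3‖ ≤ ‖x 2 0‖ ∨ ‖x 2 2‖ ≤ ‖x 2 1‖ ∧ ‖x 2 3‖ ≤ ‖x 2 1‖) →
      x ∉ PIprime p L σ ∧ x ∉ Ps1Iprime p L σ := by
    intro x hx
    refine ⟨fun h => ?_, fun h => ?_⟩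
    · obtain ⟨h0, h1⟩ := PIprime_norm_lt h
      exact hx.elim (fun h => h.1.not_gt h0) (fun h => h.1.not_gt h1)
    · obtain ⟨h0, h1⟩ := Ps1Iprime_norm_lt h
      exact hx.elim (fun h => h.2.not_gt h0) (fun h => h.2.not_gt h1)
  refine ⟨?_, fun l m hm => ⟨?_, ?_, ?_⟩, fun l => ?_⟩
  · refine Set.eq_empty_iff_forall_notMem.mpr fun x hx => ?_
    exact hirr x hx.2 (hasRationalRow_of_PKprime hσalg hiso hx.1)
  · rw [t3_eq, t5_eq]
    exact ⟨(hmem l m hm 1 (by simp)).1, (hmem l m hm 0 (by simp)).1⟩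
  · rw [t4_eq, t6_eq]
    exact ⟨(hmem l m hm 1 (by simp)).2, (hmem l m hm 0 (by simp)).2⟩
  · have h1 := hnotmem (Theta p L σ sqd b c * mapL p L (hmat p l m * t1 p))
      (Or.inl (by simp [hrow, t1_eq, hiso, hαn, -norm_pow, hpm]))
    have h2 := hnotmem (Theta p L σ sqd b c * mapL p L (hmat p l m * t2 p))
      (Or.inr (by simp [hrow, t2_eq, hiso, hαn, -norm_pow, hpm]))
    have h7 := hnotmem (Theta p L σ sqd b c * mapL p L (hmat p l m * t7 p))
      (Or.inl (by simp [hrow, t7_eq]))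
    have h8 := hnotmem (Theta p L σ sqd b c * mapL p L (hmat p l m * t8 p))
      (Or.inr (by simp [hrow, t8_eq]))
    exact ⟨h1.1, h1.2, h2.1, h2.2, h7.1, h7.2, h8.1, h8.2⟩
  · have hΘ : ∀ t ∈ Kp p, Theta p L σ sqd b c * mapL p L (hmat p l 0 * t)
        ∈ PThetaKprime p L σ sqd b c := fun t ht => Theta_hmat_zero_mem hσalg hn l ht
    have hnot : ∀ x ∈ PThetaKprime p L σ sqd b c, x ∉ PIprime p L σ ∧ x ∉ Ps1Iprime p L σ :=
      fun x hx => ⟨fun h => hirr x hx (hasRationalRow_of_PIprime hσalg hiso h),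
        fun h => hirr x hx (hasRationalRow_of_Ps1Iprime hσalg hiso h)⟩
    have h1 := hΘ _ t1_mem_Kp
    have h2 := hΘ _ t2_mem_Kp
    have h5 : Theta p L σ sqd b c * mapL p L (hmat p l 0 * t5 p) ∈ PThetaKprime p L σ sqd b c := by
      rw [t5_eq]; exact hΘ _ (lowerMat_mem_Kp (by simp))
    have h7 := hΘ _ t7_mem_Kp
    exact ⟨⟨h1, h2, h5, h7⟩, (hnot _ h1).1, (hnot _ h1).2, (hnot _ h2).1, (hnot _ h2).2,
      (hnot _ h5).1, (hnot _ h5).2, (hnot _ h7).1, (hnot _ h7).2⟩
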